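/- Let c ∈ (1,2) be non-integer, p(t) = t^c, and define μ_j as the measure ∑_{2^{j−1} < n ≤ 2^j} (e^{2πi p(n)}/n) δ_n on ℤ. Then there exist ε > 0 and C₀ ≥ 1, depending only on c, such that for all integers k, j with k + C₀ ≤ j, ‖μ_j * μ̃_k‖_{ℓ^∞} ≤ C 2^{−εk − j}. -/

import Mathlib

open Finset

/-- The measure `μ_j = ∑_{2^{j-1} < n ≤ 2^j} (e(n^c)/n) δ_n` on `ℤ`, as a function. -/
noncomputable def fracMu (c : ℝ) (j : ℕ) : ℤ → ℂ :=
  fun n => if 2 ^ (j - 1) < n ∧ n ≤ 2 ^ j then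
    Complex.exp (2 * Real.pi * Complex.I * (((n : ℝ) ^ c : ℝ))) / (n : ℂ) else 0

/-- Convolution on `ℤ`. -/
noncomputable def zconv (g h : ℤ → ℂ) : ℤ → ℂ :=
  fun x => ∑' n : ℤ, g n * h (x - n)

/-- Reflection and conjugation: `μ̃(x) = conj (μ (-x))`. -/
noncomputable def zrefl (g : ℤ → ℂ) : ℤ → ℂ :=
  fun x => starRingEnd ℂ (g (-x))


noncomputable def eexp (t : ℝ) : ℂ := Complex.exp ((2 * Real.pi * t : ℝ) * Complex.I)

lemma eexp_norm (t : ℝ) : ‖eexp t‖ = 1 := Complex.norm_exp_ofReal_mul_I _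

lemma eexp_add (s t : ℝ) : eexp (s + t) = eexp s * eexp t := by
  unfold eexp
  rw [← Complex.exp_add]; congr 1; push_cast; ring

lemma eexp_sub_norm (s t : ℝ) : ‖eexp s - eexp t‖ ≤ 2 * Real.pi * |s - t| := by
  have h : eexp s = eexp t * eexp (s - t) := by rw [← eexp_add]; congr 1; ring
  rw [h, ← mul_sub_one, norm_mul, eexp_norm, one_mul]
  have := Real.norm_exp_I_mul_ofReal_sub_one_le (x := 2 * Real.pi * (s - t))
  rw [Real.norm_eq_abs, abs_mul, abs_of_pos (by positivity : 0 < 2 * Real.pi), mul_comm Complex.I] at this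
  exact this

lemma eexp_lower (t : ℝ) : |t - round t| ≤ ‖eexp t - 1‖ := by
  have h : eexp t = eexp (t - round t) := by
    have h1 : eexp (round t : ℤ) = 1 := by
      unfold eexp
      rw [Complex.exp_eq_one_iff]
      exact ⟨round t, by push_cast; ring⟩
    have := eexp_add (t - round t) (round t)
    rw [h1, mul_one] at this
    rw [← this]; congr 1; ring
  rw [h]
  have h2 := abs_sub_round t
  generalize t - (round t : ℝ) = y at *
  unfold eexp
  rw [mul_comm _ Complex.I, Complex.norm_exp_I_mul_ofReal_sub_one, Real.norm_eq_abs, abs_mul]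
  have h3 : (2:ℝ) * Real.pi * y / 2 = Real.pi * y := by ring
  rw [h3]
  have h4 : 2 / Real.pi * |Real.pi * y| ≤ |Real.sin (Real.pi * y)| := by
    apply Real.mul_abs_le_abs_sin
    rw [abs_mul, abs_of_pos Real.pi_pos]
    nlinarith [Real.pi_pos]
  rw [abs_mul, abs_of_pos Real.pi_pos] at h4
  have h5 : 2 / Real.pi * (Real.pi * |y|) = 2 * |y| := by field_simp
  rw [h5] at h4
  have := abs_nonneg y
  rw [abs_of_pos (by norm_num : (0:ℝ) < 2)]
  linarith

lemma abel_w (w E : ℕ → ℂ) (hE : ∀ i, ‖E i‖ = 1) (n : ℕ) :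
    ‖∑ i ∈ range (n+1), w i * (E (i+1) - E i)‖ ≤
      ‖w n‖ + ‖w 0‖ + ∑ i ∈ range n, ‖w (i+1) - w i‖ := by
  have key : ∑ i ∈ range (n+1), w i * (E (i+1) - E i)
      = w n * E (n+1) - w 0 * E 0 - ∑ i ∈ range n, (w (i+1) - w i) * E (i+1) := by
    induction n with
    | zero => simp; ring
    | succ n ih => rw [sum_range_succ, ih, sum_range_succ]; ring
  rw [key]
  refine (norm_sub_le _ _).trans ?_
  gcongr
  · refine (norm_sub_le _ _).trans ?_
    simp [hE]
  · refine (norm_sum_le _ _).trans ?_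
    simp [hE]

lemma abel_a (a : ℕ → ℝ) (z : ℕ → ℂ) (ha : Antitone a) (h0 : ∀ i, 0 ≤ a i) (B : ℝ) (N : ℕ)
    (hB : ∀ n ≤ N, ‖∑ i ∈ range n, z i‖ ≤ B) :
    ‖∑ i ∈ range N, (a i : ℂ) * z i‖ ≤ a 0 * B := by
  have key : ∀ n, ∑ i ∈ range n, (a i : ℂ) * z i
      = a n * ∑ i ∈ range n, z i + ∑ i ∈ range n, ((a i - a (i+1) : ℝ) : ℂ) * ∑ l ∈ range (i+1), z l := by
    intro n
    induction n with
    | zero => simp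
    | succ n ih =>
      rw [sum_range_succ, ih, sum_range_succ _ n, sum_range_succ _ n, sum_range_succ _ n]
      push_cast; ring
  rw [key]
  have hB0 : 0 ≤ B := (norm_nonneg _).trans (hB 0 (Nat.zero_le _))
  calc _ ≤ a N * B + ∑ i ∈ range N, (a i - a (i+1)) * B := by
        refine (norm_add_le _ _).trans ?_
        gcongr
        · rw [norm_mul, Complex.norm_real, Real.norm_eq_abs, abs_of_nonneg (h0 _)]
          exact mul_le_mul_of_nonneg_left (hB N le_rfl) (h0 _)
        · refine (norm_sum_le _ _).trans (sum_le_sum fun i hi => ?_)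
          have hi' := mem_range.1 hi
          have h1 : 0 ≤ a i - a (i+1) := sub_nonneg.2 (ha (Nat.le_succ i))
          rw [norm_mul, Complex.norm_real, Real.norm_eq_abs, abs_of_nonneg h1]
          exact mul_le_mul_of_nonneg_left (hB _ hi') h1
    _ = a 0 * B := by rw [← sum_mul, sum_range_sub']; ring

/-- regularised inverse -/
noncomputable def rinv (δ : ℝ) (z : ℂ) : ℂ := starRingEnd ℂ z / ((‖z‖ ^ 2 + δ ^ 2 : ℝ) : ℂ)

lemma rinv_norm (δ : ℝ) (hδ : 0 < δ) (z : ℂ) : ‖rinv δ z‖ ≤ 1 / (2 * δ) := by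
  unfold rinv
  have h : 0 < ‖z‖^2 + δ^2 := by positivity
  rw [norm_div, Complex.norm_real, Real.norm_eq_abs, abs_of_pos h, RCLike.norm_conj,
    div_le_div_iff₀ h (by positivity)]
  nlinarith [sq_nonneg (‖z‖ - δ)]

lemma rinv_mul (δ : ℝ) (hδ : 0 < δ) (z : ℂ) :
    rinv δ z * z = 1 - ((δ ^ 2 / (‖z‖ ^ 2 + δ ^ 2) : ℝ) : ℂ) := by
  unfold rinv
  have h : 0 < ‖z‖^2 + δ^2 := by positivity
  have h' : ((‖z‖^2 + δ^2 : ℝ) : ℂ) ≠ 0 := by exact_mod_cast h.ne'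
  rw [div_mul_eq_mul_div, Complex.conj_mul']
  rw [Complex.ofReal_div, eq_sub_iff_add_eq, ← add_div, div_eq_one_iff_eq h']
  push_cast; ring

lemma rinv_lip (δ : ℝ) (hδ : 0 < δ) (z w : ℂ) : ‖rinv δ z - rinv δ w‖ ≤ ‖z - w‖ / δ ^ 2 := by
  unfold rinv
  have h : 0 < ‖z‖^2 + δ^2 := by positivity
  have h1 : 0 < ‖w‖^2 + δ^2 := by positivity
  have h' : ((‖z‖^2 + δ^2 : ℝ) : ℂ) ≠ 0 := by exact_mod_cast h.ne'
  have h1' : ((‖w‖^2 + δ^2 : ℝ) : ℂ) ≠ 0 := by exact_mod_cast h1.ne'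
  rw [div_sub_div _ _ h' h1', norm_div, norm_mul, Complex.norm_real, Complex.norm_real,
    Real.norm_eq_abs, Real.norm_eq_abs, abs_of_pos h, abs_of_pos h1,
    div_le_div_iff₀ (by positivity) (by positivity)]
  have e : (starRingEnd ℂ) z * ((‖w‖^2 + δ^2 : ℝ) : ℂ) - ((‖z‖^2 + δ^2 : ℝ) : ℂ) * (starRingEnd ℂ) w
      = ((δ^2 : ℝ) : ℂ) * (starRingEnd ℂ) (z - w) - (starRingEnd ℂ) z * (starRingEnd ℂ) w * (z - w) := by
    push_cast
    rw [← Complex.conj_mul' z, ← Complex.conj_mul' w, map_sub]; ring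
  rw [e]
  have n1 : ‖((δ^2 : ℝ) : ℂ) * (starRingEnd ℂ) (z - w) - (starRingEnd ℂ) z * (starRingEnd ℂ) w * (z - w)‖
      ≤ (δ^2 + ‖z‖ * ‖w‖) * ‖z - w‖ := by
    refine (norm_sub_le _ _).trans ?_
    rw [norm_mul, norm_mul, norm_mul, RCLike.norm_conj, RCLike.norm_conj, RCLike.norm_conj, Complex.norm_real,
      Real.norm_eq_abs, abs_of_pos (by positivity : 0 < δ^2)]
    apply le_of_eq; ring
  have n2 : (δ^2 + ‖z‖ * ‖w‖) * δ^2 ≤ (‖z‖ ^ 2 + δ ^ 2) * (‖w‖ ^ 2 + δ ^ 2) := by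
    nlinarith [sq_nonneg (‖z‖ - ‖w‖), sq_nonneg (‖z‖ * ‖w‖), mul_nonneg (sq_nonneg δ) (sq_nonneg (‖z‖ - ‖w‖)),
      mul_nonneg (sq_nonneg δ) (mul_nonneg (norm_nonneg z) (norm_nonneg w))]
  calc _ ≤ (δ^2 + ‖z‖ * ‖w‖) * ‖z - w‖ * δ^2 := by gcongr
    _ = ‖z - w‖ * ((δ^2 + ‖z‖ * ‖w‖) * δ^2) := by ring
    _ ≤ _ := by gcongr

lemma step_bounds (θ : ℕ → ℝ) (N : ℕ) (lam mu : ℝ)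
    (h : ∀ i, i + 1 < N → lam ≤ θ i - θ (i+1) ∧ θ i - θ (i+1) ≤ mu) (i d : ℕ) (hd : i + d < N) :
    lam * d ≤ θ i - θ (i+d) ∧ θ i - θ (i+d) ≤ mu * d := by
  induction d with
  | zero => simp
  | succ d ih =>
    have h1 := ih (by omega)
    have h2 := h (i+d) (by omega)
    rw [← add_assoc]
    push_cast
    constructor <;> linarith [h1.1, h1.2, h2.1, h2.2]

lemma count_bad (θ : ℕ → ℝ) (N : ℕ) (lam mu η : ℝ) (hl : 0 < lam) (hm : 0 < mu) (hη : 0 < η)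
    (h : ∀ i, i + 1 < N → lam ≤ θ i - θ (i+1) ∧ θ i - θ (i+1) ≤ mu) :
    (((range N).filter (fun i => |θ i - round (θ i)| < η)).card : ℝ)
      ≤ (N * mu + 2) * (2 * η / lam + 1) := by
  set B := (range N).filter (fun i => |θ i - round (θ i)| < η) with hBdef
  set Q : ℕ := ⌊2 * η / lam⌋₊ + 1 with hQ
  have hfib : ∀ b ∈ B.image (fun i => round (θ i)), (B.filter (fun i => round (θ i) = b)).card ≤ Q := by
    intro b hb
    set T := B.filter (fun i => round (θ i) = b) with hT
    rcases T.eq_empty_or_nonempty with h0 | hne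
    · rw [h0]; simp
    · have hsub : T ⊆ Icc (T.min' hne) (T.max' hne) := fun i hi =>
        mem_Icc.2 ⟨T.min'_le i hi, T.le_max' i hi⟩
      refine (card_le_card hsub).trans ?_
      rw [Nat.card_Icc]
      have m1 := T.min'_mem hne
      have m2 := T.max'_mem hne
      have m3 := T.min'_le _ m2
      generalize T.min' hne = p at *
      generalize T.max' hne = q at *
      obtain ⟨d, rfl⟩ := Nat.exists_eq_add_of_le m3
      simp only [hT, hBdef, mem_filter, mem_range] at m1 m2
      have s := (step_bounds θ N lam mu h p d m2.1.1).1
      have a1 := abs_lt.1 m1.1.2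
      have a2 := abs_lt.1 m2.1.2
      rw [m1.2] at a1
      rw [m2.2] at a2
      have : d ≤ ⌊2 * η / lam⌋₊ := by
        apply Nat.le_floor
        rw [le_div_iff₀ hl]
        linarith [a1.1, a1.2, a2.1, a2.2]
      omega
  have h1 := card_le_mul_card_image B Q hfib
  have h2 : ((B.image (fun i => round (θ i))).card : ℝ) ≤ N * mu + 2 := by
    rcases Nat.eq_zero_or_pos N with h0 | hN
    · have : B = ∅ := by rw [hBdef, h0]; simp
      rw [this]; simp; positivity
    have hsub : B.image (fun i => round (θ i)) ⊆ Icc (round (θ (N-1))) (round (θ 0)) := by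
      intro b hb
      obtain ⟨i, hi, rfl⟩ := mem_image.1 hb
      have hi' : i < N := mem_range.1 (mem_filter.1 hi).1
      have s1 := (step_bounds θ N lam mu h 0 i (by omega)).1
      have s2 := (step_bounds θ N lam mu h i (N-1-i) (by omega)).1
      rw [show i + (N-1-i) = N-1 by omega] at s2
      rw [zero_add] at s1
      have p1 : 0 ≤ lam * (i:ℝ) := by positivity
      have p2 : 0 ≤ lam * ((N-1-i : ℕ):ℝ) := by positivity
      rw [mem_Icc, round_eq, round_eq, round_eq]
      exact ⟨Int.floor_mono (by linarith), Int.floor_mono (by linarith)⟩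
    have hc : ((B.image (fun i => round (θ i))).card : ℝ) ≤ ((Icc (round (θ (N-1))) (round (θ 0))).card : ℝ) := by
      exact_mod_cast card_le_card hsub
    refine hc.trans ?_
    have s := step_bounds θ N lam mu h 0 (N-1) (by omega)
    rw [zero_add] at s
    have p2 : 0 ≤ lam * ((N-1 : ℕ):ℝ) := by positivity
    have mono : round (θ (N-1)) ≤ round (θ 0) := by
      rw [round_eq, round_eq]; exact Int.floor_mono (by linarith [s.1])
    have e : ((Icc (round (θ (N-1))) (round (θ 0))).card : ℝ) = (round (θ 0) : ℝ) + 1 - round (θ (N-1)) := by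
      rw [Int.card_Icc]
      have : (((round (θ 0) + 1 - round (θ (N-1))).toNat : ℤ) : ℝ) = ((round (θ 0) + 1 - round (θ (N-1)) : ℤ) : ℝ) := by
        rw [Int.toNat_of_nonneg (by omega)]
      push_cast at this
      exact this
    rw [e]
    have r1 := abs_le.1 (abs_sub_round (θ 0))
    have r2 := abs_le.1 (abs_sub_round (θ (N-1)))
    have : mu * ((N-1 : ℕ):ℝ) ≤ N * mu := by
      rw [mul_comm]; gcongr; omega
    linarith [r1.1, r1.2, r2.1, r2.2, s.2]
  have h3 : (Q : ℝ) ≤ 2 * η / lam + 1 := by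
    rw [hQ]; push_cast
    have := Nat.floor_le (by positivity : 0 ≤ 2 * η / lam)
    linarith
  calc (B.card : ℝ) ≤ Q * ((B.image (fun i => round (θ i))).card : ℝ) := by exact_mod_cast h1
    _ ≤ (2 * η / lam + 1) * (N * mu + 2) := by gcongr
    _ = _ := by ring

lemma expsum (f : ℕ → ℝ) (N : ℕ) (lam mu δ η : ℝ) (hl : 0 < lam) (hm : 0 < mu) (hδ : 0 < δ) (hη : 0 < η)
    (h : ∀ i, i + 1 < N → lam ≤ (f (i+1) - f i) - (f (i+2) - f (i+1))
      ∧ (f (i+1) - f i) - (f (i+2) - f (i+1)) ≤ mu) :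
    ‖∑ i ∈ range N, eexp (f i)‖ ≤ 1 / δ + N * (2 * Real.pi * mu / δ ^ 2)
      + ((N * mu + 2) * (2 * η / lam + 1) + N * (δ ^ 2 / η ^ 2)) := by
  set θ : ℕ → ℝ := fun i => f (i+1) - f i with hθ
  set z : ℕ → ℂ := fun i => eexp (θ i) - 1 with hz
  set r : ℕ → ℝ := fun i => δ ^ 2 / (‖z i‖ ^ 2 + δ ^ 2) with hr
  have hE : ∀ i, eexp (f i) = rinv δ (z i) * (eexp (f (i+1)) - eexp (f i)) + (r i : ℂ) * eexp (f i) := by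
    intro i
    have : eexp (f (i+1)) = eexp (θ i) * eexp (f i) := by
      rw [← eexp_add]; congr 1; simp [hθ]
    have h2 := rinv_mul δ hδ (z i)
    have h3 : eexp (f (i+1)) - eexp (f i) = z i * eexp (f i) := by rw [this, hz]; ring
    rw [h3, ← mul_assoc, h2]; ring
  rw [sum_congr rfl (fun i _ => hE i), sum_add_distrib]
  refine (norm_add_le _ _).trans (add_le_add ?_ ?_)
  · rcases N with _ | n
    · simp; positivity
    refine (abel_w (fun i => rinv δ (z i)) (fun i => eexp (f i)) (fun i => eexp_norm _) n).trans ?_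
    have b : ∀ i, ‖rinv δ (z i)‖ ≤ 1 / (2 * δ) := fun i => rinv_norm δ hδ _
    have e : 1 / δ = 1 / (2 * δ) + 1 / (2 * δ) := by field_simp; norm_num
    have hs : ∑ i ∈ range n, ‖rinv δ (z (i+1)) - rinv δ (z i)‖ ≤ ∑ i ∈ range n, 2 * Real.pi * mu / δ ^ 2 := by
      refine sum_le_sum fun i hi => (rinv_lip δ hδ _ _).trans ?_
      have hh := h i (by have := mem_range.1 hi; omega)
      gcongr
      simp only [hz, sub_sub_sub_cancel_right]
      refine (eexp_sub_norm _ _).trans ?_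
      gcongr
      rw [abs_sub_comm, abs_of_nonneg (by simp only [hθ]; linarith [hh.1])]
      exact hh.2
    rw [sum_const, card_range, nsmul_eq_mul] at hs
    have : (n:ℝ) * (2 * Real.pi * mu / δ ^ 2) ≤ ((n+1:ℕ):ℝ) * (2 * Real.pi * mu / δ ^ 2) := by
      gcongr; omega
    linarith [b n, b 0]
  · refine (norm_sum_le _ _).trans ?_
    have e : ∀ i ∈ range N, ‖(r i : ℂ) * eexp (f i)‖ ≤ (if |θ i - round (θ i)| < η then 1 else 0) + δ^2/η^2 := by
      intro i _
      rw [norm_mul, eexp_norm, mul_one, Complex.norm_real, Real.norm_eq_abs, abs_of_nonneg (by positivity)]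
      split_ifs with hi
      · have : r i ≤ 1 := by
          simp only [hr]; rw [div_le_one (by positivity)]; nlinarith [sq_nonneg ‖z i‖]
        have : 0 ≤ δ^2/η^2 := by positivity
        linarith
      · have h1 : η ≤ ‖z i‖ := (not_lt.1 hi).trans (eexp_lower _)
        have h2 : η^2 ≤ ‖z i‖^2 := by gcongr
        rw [zero_add]
        simp only [hr]
        gcongr
        nlinarith [sq_nonneg δ]
    refine (sum_le_sum e).trans ?_
    rw [sum_add_distrib, sum_const, card_range, nsmul_eq_mul, sum_boole]
    gcongr
    exact count_bad θ N lam mu η hl hm hη h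

lemma second_diff (c : ℝ) (hc1 : 1 < c) (hc2 : c < 2) (t : ℝ) (ht : 0 < t) :
    ∃ ζ, t < ζ ∧ ζ < t + 2 ∧
      (t + 2) ^ c - (t + 1) ^ c - ((t + 1) ^ c - t ^ c) = c * (c - 1) * ζ ^ (c - 2) := by
  have hd : ∀ (b y : ℝ), 0 < y → HasDerivAt (fun u : ℝ => u ^ b) (b * y ^ (b - 1)) y :=
    fun b y hy => Real.hasDerivAt_rpow_const (Or.inl hy.ne')
  have hd1 : ∀ y : ℝ, 0 < y → HasDerivAt (fun u : ℝ => (u + 1) ^ c - u ^ c)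
      (c * (y + 1) ^ (c - 1) - c * y ^ (c - 1)) y := by
    intro y hy
    exact ((hd c (y+1) (by linarith)).comp_add_const y 1).sub (hd c y hy)
  obtain ⟨ξ, hξ, e1⟩ := exists_hasDerivAt_eq_slope (fun u : ℝ => (u + 1) ^ c - u ^ c)
    (fun y => c * (y + 1) ^ (c - 1) - c * y ^ (c - 1)) (show t < t + 1 by linarith)
    (fun y hy => (hd1 y (by linarith [hy.1])).continuousAt.continuousWithinAt)
    (fun y hy => hd1 y (by linarith [hy.1]))
  have hξ0 : 0 < ξ := by linarith [hξ.1]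
  obtain ⟨ζ, hζ, e2⟩ := exists_hasDerivAt_eq_slope (fun u : ℝ => u ^ (c - 1))
    (fun y => (c - 1) * y ^ (c - 1 - 1)) (show ξ < ξ + 1 by linarith)
    (fun y hy => (hd _ y (by linarith [hy.1])).continuousAt.continuousWithinAt)
    (fun y hy => hd _ y (by linarith [hy.1]))
  refine ⟨ζ, by linarith [hξ.1, hζ.1], by linarith [hξ.2, hζ.2], ?_⟩
  simp only [add_sub_cancel_left, div_one] at e1 e2
  rw [show t + 1 + 1 = t + 2 by ring] at e1
  rw [show c - 1 - 1 = c - 2 by ring] at e2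
  rw [← e1, mul_assoc, e2]; ring

lemma final_arith (l m v K N : ℝ) (hl : 0 < l) (hm : 0 < m) (hv : 0 < v) (hv1 : v ≤ 1)
    (hK : 1 ≤ K * v ^ 8) (hN0 : 0 ≤ N) (hN : N ≤ K) :
    (1 / v ^ 2 + N * (2 * Real.pi * (m * v ^ 8) / (v ^ 2) ^ 2)
      + ((N * (m * v ^ 8) + 2) * (2 * v / (l * v ^ 8) + 1) + N * ((v ^ 2) ^ 2 / v ^ 2))) + 1
      ≤ (3 + 2 * Real.pi * m + (m + 2) * (2 / l + 1)) * (K * v) := by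
  have hpi := Real.pi_pos
  have hK0 : 0 < K := by
    by_contra h
    have : K * v^8 ≤ 0 := mul_nonpos_of_nonpos_of_nonneg (not_lt.1 h) (by positivity)
    linarith
  have pw : ∀ n : ℕ, 1 ≤ n → v ^ n ≤ v := fun n hn => by
    simpa using pow_le_pow_of_le_one hv.le hv1 hn
  have t1 : 1 / v ^ 2 ≤ K * v := by
    rw [div_le_iff₀ (by positivity)]
    refine hK.trans ?_
    have := pow_le_pow_of_le_one hv.le hv1 (show 3 ≤ 8 by norm_num)
    nlinarith
  have t2 : N * (2 * Real.pi * (m * v ^ 8) / (v ^ 2) ^ 2) ≤ 2 * Real.pi * m * (K * v) := by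
    have : N * (2 * Real.pi * (m * v ^ 8) / (v ^ 2) ^ 2) = 2 * Real.pi * m * (N * v ^ 4) := by
      field_simp
    rw [this]
    gcongr
    exact pw 4 (by norm_num)
  have t3 : (N * (m * v ^ 8) + 2) * (2 * v / (l * v ^ 8) + 1) ≤ (m + 2) * (2 / l + 1) * (K * v) := by
    have a1 : N * (m * v ^ 8) + 2 ≤ (m + 2) * (K * v ^ 8) := by
      have : N * (m * v ^ 8) ≤ K * (m * v ^ 8) := by gcongr
      nlinarith
    have a2 : 2 * v / (l * v ^ 8) + 1 ≤ (2 / l + 1) / v ^ 7 := by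
      have e : 2 * v / (l * v ^ 8) = 2 / l / v ^ 7 := by field_simp
      have : 1 ≤ 1 / v ^ 7 := by
        rw [le_div_iff₀ (by positivity), one_mul]; exact pow_le_one₀ hv.le hv1
      rw [e, add_div]; linarith
    calc _ ≤ (m + 2) * (K * v ^ 8) * ((2 / l + 1) / v ^ 7) := by gcongr
      _ = _ := by field_simp
  have t4 : N * ((v ^ 2) ^ 2 / v ^ 2) ≤ K * v := by
    have : (v ^ 2) ^ 2 / v ^ 2 = v ^ 2 := by field_simp
    rw [this]
    gcongr
    exact pw 2 (by norm_num)
  have t5 : 1 ≤ K * v := hK.trans (by gcongr; exact pw 8 (by norm_num))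
  linarith

lemma partial_bound (c : ℝ) (hc1 : 1 < c) (hc2 : c < 2) (K J : ℝ) (hK : 1 ≤ K) (hJ : 2 * K ≤ J)
    (y w : ℝ) (hy : K / 2 ≤ y) (hw : J ≤ w) (N : ℕ) (hN : y + N ≤ K) :
    ‖∑ i ∈ range (N + 1), eexp ((w + i) ^ c - (y + i) ^ c)‖ ≤
      (3 + 2 * Real.pi * (c * (c - 1) * 2 ^ (2 - c))
        + (c * (c - 1) * 2 ^ (2 - c) + 2) * (2 / (c * (c - 1) * (1 - 2 ^ (c - 2))) + 1))
        * (K * K ^ (-((2 - c) / 8))) := by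
  have hK0 : 0 < K := by linarith
  set v := K ^ (-((2 - c) / 8)) with hv
  have hv0 : 0 < v := by positivity
  have hv1 : v ≤ 1 := Real.rpow_le_one_of_one_le_of_nonpos hK (by linarith)
  have hv8 : v ^ 8 = K ^ (c - 2) := by
    rw [hv, ← Real.rpow_natCast, ← Real.rpow_mul hK0.le]; congr 1; push_cast; ring
  have hKv : 1 ≤ K * v ^ 8 := by
    rw [hv8]
    have e : K * K ^ (c - 2) = K ^ (1 + (c - 2)) := by rw [Real.rpow_add hK0, Real.rpow_one]
    rw [e]
    exact Real.one_le_rpow hK (by linarith)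
  have h2 : (2:ℝ) ^ (c - 2) < 1 := Real.rpow_lt_one_of_one_lt_of_neg (by norm_num) (by linarith)
  have hcc : 0 < c * (c - 1) := by nlinarith
  set l := c * (c - 1) * (1 - 2 ^ (c - 2)) with hl
  set m := c * (c - 1) * (2:ℝ) ^ (2 - c) with hm
  have hl0 : 0 < l := mul_pos hcc (by linarith)
  have hm0 : 0 < m := by positivity
  have hNK : (N:ℝ) ≤ K := by linarith
  refine le_trans ?_ (final_arith l m v K N hl0 hm0 hv0 hv1 hKv (by positivity) hNK)
  rw [sum_range_succ]
  refine (norm_add_le _ _).trans ?_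
  rw [eexp_norm]
  gcongr
  apply expsum (fun i : ℕ => (w + i) ^ c - (y + i) ^ c) N (l * v ^ 8) (m * v ^ 8) (v ^ 2) v
    (by positivity) (by positivity) (by positivity) hv0
  intro i hi
  have hi' : (i:ℝ) + 2 ≤ N := by exact_mod_cast hi
  have hi0 : (0:ℝ) ≤ i := by positivity
  obtain ⟨a, a1, a2, a3⟩ := second_diff c hc1 hc2 (y + i) (by linarith)
  obtain ⟨b, b1, b2, b3⟩ := second_diff c hc1 hc2 (w + i) (by linarith)
  have e : ((w + ((i+1 : ℕ):ℝ)) ^ c - (y + ((i+1 : ℕ):ℝ)) ^ c - ((w + i) ^ c - (y + i) ^ c)) -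
      ((w + ((i+2 : ℕ):ℝ)) ^ c - (y + ((i+2 : ℕ):ℝ)) ^ c - ((w + ((i+1 : ℕ):ℝ)) ^ c - (y + ((i+1 : ℕ):ℝ)) ^ c))
      = c * (c - 1) * (a ^ (c - 2) - b ^ (c - 2)) := by
    rw [mul_sub, ← a3, ← b3]; push_cast
    rw [← add_assoc, ← add_assoc, ← add_assoc, ← add_assoc]; ring
  rw [e, hv8]
  have ha0 : 0 < a := by linarith
  have hb0 : 0 < b := by linarith
  have u1 : K ^ (c - 2) ≤ a ^ (c - 2) :=
    Real.rpow_le_rpow_of_nonpos ha0 (by linarith) (by linarith)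
  have u2 : b ^ (c - 2) ≤ 2 ^ (c - 2) * K ^ (c - 2) := by
    rw [← Real.mul_rpow (by norm_num) hK0.le]
    exact Real.rpow_le_rpow_of_nonpos (by positivity) (by linarith) (by linarith)
  have u3 : a ^ (c - 2) ≤ 2 ^ (2 - c) * K ^ (c - 2) := by
    have : (2:ℝ) ^ (2 - c) * K ^ (c - 2) = (K / 2) ^ (c - 2) := by
      rw [Real.div_rpow hK0.le (by norm_num), show 2 - c = -(c - 2) by ring, Real.rpow_neg (by norm_num)]
      field_simp
    rw [this]
    exact Real.rpow_le_rpow_of_nonpos (by positivity) (by linarith) (by linarith)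
  have u4 : 0 ≤ b ^ (c - 2) := by positivity
  constructor
  · rw [hl, mul_assoc (c * (c - 1))]
    gcongr
    linarith
  · rw [hm, mul_assoc (c * (c - 1))]
    gcongr
    linarith

lemma conv_term (c : ℝ) (j k : ℕ) (x m : ℤ) :
    fracMu c j m * zrefl (fracMu c k) (x - m) =
      if m ∈ Ioc (max (2 ^ (j-1)) (2 ^ (k-1) + x)) (min (2 ^ j) (2 ^ k + x)) then
        ((1 / ((m:ℝ) * ((m:ℝ) - x)) : ℝ) : ℂ) * eexp ((m:ℝ) ^ c - ((m:ℝ) - x) ^ c) else 0 := by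
  have hcond : m ∈ Ioc (max (2 ^ (j-1)) (2 ^ (k-1) + x)) (min (2 ^ j) (2 ^ k + x)) ↔
      (2 ^ (j - 1) < m ∧ m ≤ 2 ^ j) ∧ (2 ^ (k - 1) < -(x - m) ∧ -(x - m) ≤ 2 ^ k) := by
    rw [mem_Ioc, max_lt_iff, le_min_iff]
    constructor
    · rintro ⟨⟨h1, h2⟩, h3, h4⟩; refine ⟨⟨h1, h3⟩, ?_, ?_⟩ <;> linarith
    · rintro ⟨⟨h1, h2⟩, h3, h4⟩; refine ⟨⟨h1, ?_⟩, h2, ?_⟩ <;> linarith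
  unfold zrefl fracMu
  by_cases h1 : 2 ^ (j - 1) < m ∧ m ≤ 2 ^ j
  · by_cases h2 : 2 ^ (k - 1) < -(x - m) ∧ -(x - m) ≤ 2 ^ k
    · rw [if_pos (hcond.2 ⟨h1, h2⟩), if_pos h1, if_pos h2]
      have e : eexp ((m:ℝ) ^ c - ((m:ℝ) - x) ^ c) = eexp ((m:ℝ) ^ c) * (starRingEnd ℂ) (eexp (((m:ℝ) - x) ^ c)) := by
        rw [sub_eq_add_neg, eexp_add]
        congr 1
        unfold eexp
        rw [← Complex.exp_conj]
        rw [map_mul, Complex.conj_ofReal, Complex.conj_I]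
        push_cast; ring
      rw [e]
      have e2 : ∀ t : ℝ, Complex.exp (2 * Real.pi * Complex.I * (t : ℂ)) = eexp t := by
        intro t; unfold eexp; congr 1; push_cast; ring
      rw [e2, e2, map_div₀]
      have e3 : (((-(x - m) : ℤ)) : ℝ) = (m:ℝ) - x := by push_cast; ring
      have e4 : (((-(x - m) : ℤ)) : ℂ) = (m:ℂ) - x := by push_cast; ring
      rw [e3, e4]
      simp only [map_sub, map_intCast]
      push_cast
      field_simp
    · rw [if_neg h2, if_neg (fun h => h2 (hcond.1 h).2)]; simp
  · rw [if_neg h1, if_neg (fun h => h1 (hcond.1 h).1)]; simp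

lemma sum_Ioc_range (A B : ℤ) (g : ℤ → ℂ) :
    ∑ m ∈ Ioc A B, g m = ∑ i ∈ range (B - A).toNat, g (A + 1 + i) := by
  symm
  refine sum_nbij (fun i : ℕ => A + 1 + (i:ℤ)) ?_ ?_ ?_ ?_
  · intro i hi; have := mem_range.1 hi; rw [mem_Ioc]; omega
  · intro a _ b _ h; simp only at h; omega
  · intro m hm
    have := mem_Ioc.1 (mem_coe.1 hm)
    refine ⟨(m - A - 1).toNat, ?_, ?_⟩
    · rw [mem_coe, mem_range]; omega
    · simp only; omega
  · intros; rfl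

/-- Off-diagonal correlation bound for the fractional monomial phase `p(t) = t^c`,
`c ∈ (1,2)` non-integer: there are `ε > 0` and `C₀ ≥ 1` such that for `k + C₀ ≤ j`,
`‖μ_j * μ̃_k‖_{ℓ^∞} ≤ C 2^{-εk - j}`. -/
theorem frac_offdiagonal (c : ℝ) (hc1 : 1 < c) (hc2 : c < 2) :
    ∃ ε : ℝ, 0 < ε ∧ ∃ C₀ : ℕ, 1 ≤ C₀ ∧ ∃ C : ℝ, 0 < C ∧
      ∀ k j : ℕ, k + C₀ ≤ j → ∀ x : ℤ,
        ‖zconv (fracMu c j) (zrefl (fracMu c k)) x‖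
          ≤ C * (2 : ℝ) ^ (-(ε * k) - j) := by
  have h2 : (2:ℝ) ^ (c - 2) < 1 := Real.rpow_lt_one_of_one_lt_of_neg (by norm_num) (by linarith)
  have hcc : 0 < c * (c - 1) := by nlinarith
  have hl0 : 0 < c * (c - 1) * (1 - 2 ^ (c - 2)) := mul_pos hcc (by linarith)
  set D : ℝ := 3 + 2 * Real.pi * (c * (c - 1) * 2 ^ (2 - c))
        + (c * (c - 1) * 2 ^ (2 - c) + 2) * (2 / (c * (c - 1) * (1 - 2 ^ (c - 2))) + 1) with hD
  have hD0 : 0 < D := by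
    have := Real.pi_pos
    positivity
  refine ⟨(2 - c) / 8, by linarith, 2, by norm_num, 4 * D, by positivity, ?_⟩
  intro k j hkj x
  unfold zconv
  simp_rw [conv_term]
  rw [tsum_eq_sum (s := Ioc (max (2 ^ (j-1)) (2 ^ (k-1) + x)) (min (2 ^ j) (2 ^ k + x)))
    (fun m hm => if_neg hm), sum_congr rfl (fun m hm => if_pos hm), sum_Ioc_range]
  set A : ℤ := max (2 ^ (j-1)) (2 ^ (k-1) + x) with hA
  set B : ℤ := min (2 ^ j) (2 ^ k + x) with hB
  have A1 : (2:ℝ) ^ (j-1) ≤ A := by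
    have : (2:ℤ) ^ (j-1) ≤ A := le_max_left _ _
    exact_mod_cast this
  have A2 : (2:ℝ) ^ (k-1) ≤ A - x := by
    have : (2:ℤ) ^ (k-1) + x ≤ A := le_max_right _ _
    have : (2:ℝ) ^ (k-1) + x ≤ A := by exact_mod_cast this
    linarith
  have B2 : (B:ℝ) - x ≤ 2 ^ k := by
    have : B ≤ (2:ℤ) ^ k + x := min_le_right _ _
    have : (B:ℝ) ≤ 2 ^ k + x := by exact_mod_cast this
    linarith
  have hj : (2:ℝ) ^ j = 2 * 2 ^ (j-1) := by
    rw [← pow_succ']; congr 1; omega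
  have hk : (2:ℝ) ^ k ≤ 2 * 2 ^ (k-1) := by
    rw [← pow_succ']; exact pow_le_pow_right₀ (by norm_num) (by omega)
  have hkj' : 2 * (2:ℝ) ^ k ≤ 2 ^ (j-1) := by
    rw [← pow_succ']; exact pow_le_pow_right₀ (by norm_num) (by omega)
  have hK1 : (1:ℝ) ≤ 2 ^ k := one_le_pow₀ (by norm_num)
  have pj : (0:ℝ) < 2 ^ (j-1) := by positivity
  have pk : (0:ℝ) < 2 ^ (k-1) := by positivity
  set K : ℝ := 2 ^ k with hKdef
  set w : ℝ := A + 1 with hw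
  set y : ℝ := A + 1 - x with hy
  have key := abel_a (fun i : ℕ => 1 / ((w + i) * (y + i)))
    (fun i : ℕ => eexp ((w + i) ^ c - (y + i) ^ c))
    (by
      intro a b hab
      have : (a:ℝ) ≤ b := by exact_mod_cast hab
      have ha0 : (0:ℝ) ≤ a := by positivity
      have w0 : 0 < w + a := by linarith
      have y0 : 0 < y + a := by linarith
      simp only
      gcongr)
    (by
      intro i
      have ha0 : (0:ℝ) ≤ i := by positivity
      have w0 : 0 < w + i := by linarith
      have y0 : 0 < y + i := by linarith
      positivity)
    (D * (K * K ^ (-((2 - c) / 8)))) (B - A).toNat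
    (by
      intro n hn
      rcases n with _ | n
      · simp; positivity
      · apply partial_bound c hc1 hc2 K (2 ^ (j-1)) hK1 hkj' y w (by linarith) (by linarith)
        have : A + 1 + n ≤ B := by omega
        have : (A:ℝ) + 1 + n ≤ B := by exact_mod_cast this
        linarith)
  have conv : ∀ i : ℕ, (((A + 1 + (i:ℤ) : ℤ)) : ℝ) - x = y + i := by
    intro i; rw [hy]; push_cast; ring
  have conv2 : ∀ i : ℕ, (((A + 1 + (i:ℤ) : ℤ)) : ℝ) = w + i := by
    intro i; rw [hw]; push_cast; ring
  simp_rw [conv, conv2]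
  refine key.trans ?_
  have f1 : 1 / ((w + ((0:ℕ):ℝ)) * (y + ((0:ℕ):ℝ))) ≤ 4 / (2 ^ j * K) := by
    rw [Nat.cast_zero, add_zero, add_zero]
    have w1 : (2:ℝ) ^ j / 2 ≤ w := by linarith
    have y1 : K / 2 ≤ y := by linarith
    have : (4:ℝ) / (2 ^ j * K) = 1 / ((2 ^ j / 2) * (K / 2)) := by field_simp; norm_num
    rw [this]
    gcongr
  have f2 : (2:ℝ) ^ (-((2 - c) / 8 * (k:ℝ)) - j) = K ^ (-((2 - c) / 8)) / 2 ^ j := by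
    rw [Real.rpow_sub (by norm_num), Real.rpow_natCast, hKdef, ← Real.rpow_natCast 2 k,
      ← Real.rpow_mul (by norm_num)]
    congr 2; ring
  rw [f2]
  calc _ ≤ 4 / (2 ^ j * K) * (D * (K * K ^ (-((2 - c) / 8)))) := by gcongr
    _ = _ := by field_simp
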